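/- Let r, ν, a ∈ ℕ with a ≤ ν. Let H be an r-uniform hypergraph which is the union of a sunflowers S_1, …, S_a, each with a nonempty core and (ν+1)·r petals, whose cores are pairwise disjoint, together with an r-uniform hypergraph R with matching number ν(R) ≤ ν − a whose vertex set is disjoint from the cores of S_1, …, S_a. Then H has matching number ν(H) ≤ ν. -/

import Mathlib

/-!
Statement 12: let `r, ν, a ∈ ℕ` with `a ≤ ν`. Let `H` be the union of `a` sunflowers
`S_1, …, S_a`, each `r`-uniform with a nonempty core and `(ν+1)·r` petals, with pairwise
disjoint cores, together with an `r`-uniform hypergraph `R` with matching number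
`ν(R) ≤ ν − a` whose vertex set is disjoint from the cores of `S_1, …, S_a`.
Then `ν(H) ≤ ν`.
-/

/-- `S` is an `r`-uniform sunflower with core `C` and `t` petals: `t` edges, each an
`r`-set containing `C`, any two of which intersect exactly in `C`. -/
def IsSunflower (r t : ℕ) (S : Finset (Finset ℕ)) (C : Finset ℕ) : Prop :=
  S.card = t ∧ (∀ e ∈ S, e.card = r ∧ C ⊆ e) ∧
    (S : Set (Finset ℕ)).Pairwise fun e f => e ∩ f = C

theorem stmt12 (r ν a : ℕ) (ha : a ≤ ν)
    (S : Fin a → Finset (Finset ℕ)) (C : Fin a → Finset ℕ)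
    (hS : ∀ i, IsSunflower r ((ν + 1) * r) (S i) (C i))
    (hCne : ∀ i, (C i).Nonempty)
    (hCdisj : ∀ i j, i ≠ j → Disjoint (C i) (C j))
    (R : Finset (Finset ℕ))
    (hRr : ∀ e ∈ R, e.card = r)
    (hRν : ∀ M ⊆ R, (M : Set (Finset ℕ)).Pairwise (fun e f => Disjoint e f) →
      M.card ≤ ν - a)
    (hRC : ∀ e ∈ R, ∀ i, Disjoint e (C i)) :
    ∀ M ⊆ Finset.univ.biUnion S ∪ R,
      (M : Set (Finset ℕ)).Pairwise (fun e f => Disjoint e f) → M.card ≤ ν := by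
  classical
  intro M hM hMd
  have h_choice : ∀ e : ↥(M \ R), ∃ i, (e : Finset ℕ) ∈ S i := by
    rintro ⟨e, he⟩
    rw [Finset.mem_sdiff] at he
    simpa [he.2] using hM he.1
  choose f hf using h_choice
  have h_inj : Function.Injective f := by
    rintro ⟨e, he⟩ ⟨e', he'⟩ hee
    by_contra hne
    have he1 := ((hS _).2.1 e (hf ⟨e, he⟩)).2
    have he2 := ((hS _).2.1 e' (hf ⟨e', he'⟩)).2
    rw [← hee] at he2
    obtain ⟨x, hx⟩ := hCne (f ⟨e, he⟩)
    exact Finset.disjoint_left.mp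
      (hMd (Finset.mem_sdiff.mp he).1 (Finset.mem_sdiff.mp he').1
        fun h => hne (Subtype.ext h)) (he1 hx) (he2 hx)
  have h_sunflowers : (M \ R).card ≤ a := by
    simpa using Fintype.card_le_of_injective f h_inj
  have h_rest : (M ∩ R).card ≤ ν - a :=
    hRν _ Finset.inter_subset_right (hMd.mono (by simp))
  have h_card := Finset.card_sdiff_add_card_inter M R
  omega
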